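/- arXiv:2003.02979 — 9 statements merged into one kernel-verified Lean document; each statement's English description precedes it below -/
import Mathlib

section
/- Let G be a finite group acting on types A and B, and let J : A → B → ℝ satisfy diagonal invariance: J (g • a) (g • b) = J a b for all g ∈ G, a ∈ A, b ∈ B. Then for all a ∈ A and b ∈ B, (1/|G|) * ∑_{g ∈ G} J a (g • b) = (1/|G|²) * ∑_{g₁ ∈ G} ∑_{g₂ ∈ G} J (g₁ • a) (g₂ • b). -/
/-- Proposition 1: the other-play return of a policy pair equals the expected
return when each player independently applies a uniformly random symmetry to
their own policy. -/
theorem other_play_prop1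
    {G A B : Type*} [Group G] [Fintype G] [MulAction G A] [MulAction G B]
    (J : A → B → ℝ)
    (hJ : ∀ (g : G) (a : A) (b : B), J (g • a) (g • b) = J a b)
    (a : A) (b : B) :
    (1 / (Fintype.card G : ℝ)) * ∑ g : G, J a (g • b)
      = (1 / (Fintype.card G : ℝ) ^ 2) * ∑ g₁ : G, ∑ g₂ : G, J (g₁ • a) (g₂ • b) := by
  have sum_smul (g₁ : G) : ∑ g₂ : G, J (g₁ • a) (g₂ • b) = ∑ g : G, J a (g • b) := by
    rw [← Equiv.sum_comp (Equiv.mulLeft g₁)]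
    simp [mul_smul, hJ]
  have card_ne_zero : (Fintype.card G : ℝ) ≠ 0 := Nat.cast_ne_zero.mpr Fintype.card_ne_zero
  simp only [sum_smul, Finset.sum_const, Finset.card_univ, nsmul_eq_mul]
  field_simp
end

section
/- Let G be a finite group acting on types A and B, and let J : A → B → ℝ satisfy diagonal invariance: J (g • a) (g • b) = J a b for all g ∈ G, a ∈ A, b ∈ B. For a ∈ A let μ_a : PMF A be the pushforward of the uniform PMF on G under g ↦ g • a, and for b ∈ B let ν_b : PMF B be the pushforward of the uniform PMF on G under g ↦ g • b (the uniform orbit mixtures). Then for all a ∈ A and b ∈ B, the other-play objective satisfies J_OP a b = ∑_{x ∈ A} ∑_{y ∈ B} (μ_a x) * (ν_b y) * J x y, where the sums range over the (finite) supports of μ_a and ν_b. -/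
/-- The expectation of a real function under the pushforward of the uniform distribution on a
finite type is the average of its values along the map. -/
theorem PMF.sum_toReal_map_uniformOfFintype_mul {ι X : Type*} [Fintype ι] [Nonempty ι]
    (f : ι → X) (F : X → ℝ)
    (hf : ((PMF.uniformOfFintype ι).map f).support.Finite) :
    ∑ x ∈ hf.toFinset, (((PMF.uniformOfFintype ι).map f) x).toReal * F x
      = (Fintype.card ι : ℝ)⁻¹ * ∑ i, F (f i) := by
  classical
  have happly (x : X) : (((PMF.uniformOfFintype ι).map f) x).toReal
      = ∑ i, if x = f i then (Fintype.card ι : ℝ)⁻¹ else 0 := by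
    rw [PMF.map_apply, tsum_fintype, ENNReal.toReal_sum]
    · refine Finset.sum_congr rfl fun i _ => ?_
      split_ifs <;> simp
    · intro i _
      split_ifs <;> simp
  have hmem (i : ι) : f i ∈ hf.toFinset := by
    rw [Set.Finite.mem_toFinset, PMF.mem_support_map_iff]
    exact ⟨i, PMF.mem_support_uniformOfFintype i, rfl⟩
  simp_rw [happly, Finset.sum_mul, ite_mul, zero_mul]
  rw [Finset.sum_comm, Finset.mul_sum]
  refine Finset.sum_congr rfl fun i _ => ?_
  rw [Finset.sum_ite_eq', if_pos (hmem i)]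

/-- Proposition 1 (restated): the other-play return of a policy pair equals the
expected return when both players independently play the uniform mixtures over
the symmetry-orbits of their policies. -/
theorem other_play_prop1_orbit_mixture
    {G A B : Type*} [Group G] [Fintype G] [MulAction G A] [MulAction G B]
    (J : A → B → ℝ)
    (hJ : ∀ (g : G) (a : A) (b : B), J (g • a) (g • b) = J a b)
    (a : A) (b : B)
    (μ : PMF A) (ν : PMF B)
    (hμ : μ = (PMF.uniformOfFintype G).map (fun g => g • a))
    (hν : ν = (PMF.uniformOfFintype G).map (fun g => g • b))
    (hμf : μ.support.Finite) (hνf : ν.support.Finite) :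
    (1 / (Fintype.card G : ℝ)) * ∑ g : G, J a (g • b)
      = ∑ x ∈ hμf.toFinset, ∑ y ∈ hνf.toFinset,
          (μ x).toReal * (ν y).toReal * J x y := by
  subst hμ hν
  have horbit (g : G) : ∑ h : G, J (g • a) (h • b) = ∑ h : G, J a (h • b) := by
    refine Fintype.sum_equiv (Equiv.mulLeft g⁻¹) _ _ fun h => ?_
    rw [← hJ g a, Equiv.coe_mulLeft, mul_smul, smul_inv_smul]
  simp_rw [mul_assoc, ← Finset.mul_sum]
  simp_rw [PMF.sum_toReal_map_uniformOfFintype_mul, horbit]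
  simp
end

section
/- Let G be a finite group acting on finite nonempty types A and B, and let J : A → B → ℝ satisfy diagonal invariance: J (g • a) (g • b) = J a b. Define J_OP a b = (1/|G|) * ∑_{g ∈ G} J a (g • b) and J_mix a b = (1/|G|²) * ∑_{g₁ ∈ G} ∑_{g₂ ∈ G} J (g₁ • a) (g₂ • b). Then max_{(a,b) ∈ A × B} J_OP a b = max_{(a,b) ∈ A × B} J_mix a b, and a pair (a, b) maximizes J_OP if and only if it maximizes J_mix. -/
/-- For a payoff invariant under the diagonal action, translating the first argument does not
change the sum over the orbit of the second. -/
theorem sum_smul_smul_eq_of_diagonal_invariant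
    {G A B M : Type*} [Group G] [Fintype G] [MulAction G A] [MulAction G B] [AddCommMonoid M]
    {J : A → B → M} (hJ : ∀ (g : G) (a : A) (b : B), J (g • a) (g • b) = J a b)
    (h : G) (a : A) (b : B) :
    ∑ g : G, J (h • a) (g • b) = ∑ g : G, J a (g • b) := by
  rw [← Equiv.sum_comp (Equiv.mulLeft h)]
  simp [mul_smul, hJ]

/-- Corollary 1: the other-play objective and the independent-mixture objective
have the same maximum value and exactly the same maximizers. -/
theorem other_play_corollary1
    {G A B : Type*} [Group G] [Fintype G] [MulAction G A] [MulAction G B]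
    [Fintype A] [Fintype B] [Nonempty A] [Nonempty B]
    (J : A → B → ℝ)
    (hJ : ∀ (g : G) (a : A) (b : B), J (g • a) (g • b) = J a b)
    (JOP Jmix : A → B → ℝ)
    (hOP : ∀ a b, JOP a b = (1 / (Fintype.card G : ℝ)) * ∑ g : G, J a (g • b))
    (hmix : ∀ a b, Jmix a b =
      (1 / (Fintype.card G : ℝ) ^ 2) * ∑ g₁ : G, ∑ g₂ : G, J (g₁ • a) (g₂ • b)) :
    (Finset.univ.sup' Finset.univ_nonempty (fun p : A × B => JOP p.1 p.2)
      = Finset.univ.sup' Finset.univ_nonempty (fun p : A × B => Jmix p.1 p.2)) ∧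
    ∀ (a : A) (b : B),
      (∀ (a' : A) (b' : B), JOP a' b' ≤ JOP a b) ↔
      (∀ (a' : A) (b' : B), Jmix a' b' ≤ Jmix a b) := by
  have hcard : (Fintype.card G : ℝ) ≠ 0 := Nat.cast_ne_zero.mpr Fintype.card_ne_zero
  have heq : Jmix = JOP := by
    funext a b
    simp only [hOP, hmix, sum_smul_smul_eq_of_diagonal_invariant hJ, Finset.sum_const,
      Finset.card_univ, nsmul_eq_mul]
    field_simp
  subst heq
  exact ⟨rfl, fun _ _ => Iff.rfl⟩
end

section
/- Let G be a finite group acting on types A and B, and let J : A → B → ℝ satisfy diagonal invariance: J (g • a) (g • b) = J a b. Then the other-play objective J_OP a b = (1/|G|) * ∑_{g ∈ G} J a (g • b) is invariant under independent symmetries applied to each argument: for all g₁, g₂ ∈ G, a ∈ A, b ∈ B, J_OP (g₁ • a) (g₂ • b) = J_OP a b. -/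
/-- The other-play objective is invariant under independent symmetries applied
to each argument. -/
theorem other_play_independent_invariance
    {G A B : Type*} [Group G] [Fintype G] [MulAction G A] [MulAction G B]
    (J : A → B → ℝ)
    (hJ : ∀ (g : G) (a : A) (b : B), J (g • a) (g • b) = J a b)
    (JOP : A → B → ℝ)
    (hOP : ∀ a b, JOP a b = (1 / (Fintype.card G : ℝ)) * ∑ g : G, J a (g • b))
    (g₁ g₂ : G) (a : A) (b : B) :
    JOP (g₁ • a) (g₂ • b) = JOP a b := by
  rw [hOP, hOP]
  congr 1
  refine Fintype.sum_equiv ((Equiv.mulLeft g₁⁻¹).trans (Equiv.mulRight g₂)) _ _ fun g => ?_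
  rw [← hJ g₁ a]
  simp [smul_smul, mul_assoc]
end

section
/- Let G be a finite group acting on types A and B, with B finite, and let J : A → B → ℝ satisfy diagonal invariance: J (g • a) (g • b) = J a b. Let ν : B → ℝ be G-invariant, i.e. ν (g • b) = ν b for all g ∈ G and b ∈ B. Then for every a ∈ A, ∑_{b ∈ B} ν b * J a b = ∑_{b ∈ B} ν b * J_OP a b, where J_OP a b = (1/|G|) * ∑_{g ∈ G} J a (g • b). -/
/-- Against a partner whose mixed strategy is symmetry-invariant, the expected
payoff of any policy under `J` equals its expected payoff under the other-play
objective. -/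
theorem other_play_invariant_partner
    {G A B : Type*} [Group G] [Fintype G] [MulAction G A] [MulAction G B]
    [Fintype B]
    (J : A → B → ℝ)
    (hJ : ∀ (g : G) (a : A) (b : B), J (g • a) (g • b) = J a b)
    (ν : B → ℝ)
    (hν : ∀ (g : G) (b : B), ν (g • b) = ν b)
    (JOP : A → B → ℝ)
    (hOP : ∀ a b, JOP a b = (1 / (Fintype.card G : ℝ)) * ∑ g : G, J a (g • b))
    (a : A) :
    ∑ b : B, ν b * J a b = ∑ b : B, ν b * JOP a b := by
  have translate (g : G) : ∑ b : B, ν b * J a (g • b) = ∑ b : B, ν b * J a b := by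
    rw [← Equiv.sum_comp (MulAction.toPerm g) fun b => ν b * J a b]
    simp only [MulAction.toPerm_apply, hν]
  have card_ne_zero : (Fintype.card G : ℝ) ≠ 0 := Nat.cast_ne_zero.mpr Fintype.card_ne_zero
  symm
  calc
    ∑ b : B, ν b * JOP a b
        = (1 / (Fintype.card G : ℝ)) * ∑ b : B, ∑ g : G, ν b * J a (g • b) := by
      simp only [hOP, Finset.mul_sum, mul_left_comm]
    _ = (1 / (Fintype.card G : ℝ)) * ∑ g : G, ∑ b : B, ν b * J a (g • b) := by
      rw [Finset.sum_comm]
    _ = ∑ b : B, ν b * J a b := by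
      simp only [translate, Finset.sum_const, Finset.card_univ, nsmul_eq_mul]
      rw [← mul_assoc, one_div_mul_cancel card_ne_zero, one_mul]
end

section
/- Let G be a finite group acting on finite nonempty types A and B, and let J : A → B → ℝ satisfy diagonal invariance: J (g • a) (g • b) = J a b. Let μ : A → ℝ and ν : B → ℝ be probability weights (μ a ≥ 0 for all a, ∑_{a ∈ A} μ a = 1, and similarly for ν) that are G-invariant (μ (g • a) = μ a and ν (g • b) = ν b for all g). Then the expected payoff ∑_{a ∈ A} ∑_{b ∈ B} μ a * ν b * J a b ≤ max_{(a,b) ∈ A × B} J_OP a b, where J_OP a b = (1/|G|) * ∑_{g ∈ G} J a (g • b). -/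
/-- Averaging a function over the group does not change its sum against invariant weights. -/
theorem sum_mul_groupAverage_of_invariant
    {G B : Type*} [Group G] [Fintype G] [MulAction G B] [Fintype B]
    (ν : B → ℝ) (hν : ∀ (g : G) (b : B), ν (g • b) = ν b) (f : B → ℝ) :
    ∑ b : B, ν b * ((1 / (Fintype.card G : ℝ)) * ∑ g : G, f (g • b)) = ∑ b : B, ν b * f b := by
  have translate (g : G) : ∑ b : B, ν b * f (g • b) = ∑ b : B, ν b * f b := by
    rw [← Equiv.sum_comp (MulAction.toPerm g) fun b => ν b * f b]
    simp [hν]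
  have card_ne : (Fintype.card G : ℝ) ≠ 0 := Nat.cast_ne_zero.mpr Fintype.card_ne_zero
  simp_rw [mul_left_comm (ν _), ← Finset.mul_sum, Finset.mul_sum _ _ (ν _)]
  rw [Finset.sum_comm]
  simp_rw [translate]
  rw [Finset.sum_const, Finset.card_univ, nsmul_eq_mul, ← mul_assoc, one_div,
    inv_mul_cancel₀ card_ne, one_mul]

/-- Proposition 2, upper bound: no pair of symmetry-invariant mixed strategies
can exceed the optimal other-play value. -/
theorem other_play_upper_bound
    {G A B : Type*} [Group G] [Fintype G] [MulAction G A] [MulAction G B]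
    [Fintype A] [Fintype B] [Nonempty A] [Nonempty B]
    (J : A → B → ℝ)
    (hJ : ∀ (g : G) (a : A) (b : B), J (g • a) (g • b) = J a b)
    (JOP : A → B → ℝ)
    (hOP : ∀ a b, JOP a b = (1 / (Fintype.card G : ℝ)) * ∑ g : G, J a (g • b))
    (μ : A → ℝ) (ν : B → ℝ)
    (hμ0 : ∀ a, 0 ≤ μ a) (hμ1 : ∑ a : A, μ a = 1)
    (hν0 : ∀ b, 0 ≤ ν b) (hν1 : ∑ b : B, ν b = 1)
    (hμinv : ∀ (g : G) (a : A), μ (g • a) = μ a)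
    (hνinv : ∀ (g : G) (b : B), ν (g • b) = ν b) :
    ∑ a : A, ∑ b : B, μ a * ν b * J a b
      ≤ Finset.univ.sup' Finset.univ_nonempty (fun p : A × B => JOP p.1 p.2) := by
  set M := Finset.univ.sup' Finset.univ_nonempty (fun p : A × B => JOP p.1 p.2)
  have le_M (a : A) (b : B) : JOP a b ≤ M :=
    Finset.le_sup' (fun p : A × B => JOP p.1 p.2) (Finset.mem_univ (a, b))
  calc ∑ a : A, ∑ b : B, μ a * ν b * J a b
      = ∑ a : A, μ a * ∑ b : B, ν b * JOP a b := by
        simp_rw [hOP, sum_mul_groupAverage_of_invariant ν hνinv, Finset.mul_sum, mul_assoc]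
    _ ≤ ∑ a : A, μ a * ∑ b : B, ν b * M := by
        gcongr with a _ b _
        · exact hμ0 a
        · exact hν0 b
        · exact le_M a b
    _ = M := by rw [← Finset.sum_mul, ← Finset.sum_mul, hμ1, hν1, one_mul, one_mul]
end

section
/- Let G be a finite group acting on finite nonempty types A and B, and let J : A → B → ℝ satisfy diagonal invariance: J (g • a) (g • b) = J a b. Suppose (a*, b*) maximizes J_OP a b = (1/|G|) * ∑_{g ∈ G} J a (g • b) over A × B. Define the uniform orbit mixtures μ* x = |{g ∈ G : g • a* = x}| / |G| and ν* y = |{g ∈ G : g • b* = y}| / |G|. Then μ* and ν* are G-invariant probability weights, and ∑_{x ∈ A} ∑_{y ∈ B} μ* x * ν* y * J x y = J_OP a* b*; consequently (μ*, ν*) attains the maximum of the expected payoff over all pairs of G-invariant probability weights. -/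
open Finset in
/-- The expectation of `f` under the uniform orbit mixture of `a` is the average of `f` over the
orbit map of `a`. -/
theorem sum_orbitMixture_mul {G X : Type*} [Group G] [Fintype G] [MulAction G X] [Fintype X]
    [DecidableEq X] (a : X) (f : X → ℝ) :
    ∑ x, ((#{g : G | g • a = x} : ℝ) / Fintype.card G) * f x =
      (1 / (Fintype.card G : ℝ)) * ∑ g : G, f (g • a) := by
  rw [← sum_fiberwise univ (fun g : G => g • a), mul_sum]
  refine sum_congr rfl fun x _ => ?_
  rw [sum_congr rfl fun g hg => congrArg f (mem_filter.1 hg).2, sum_const, nsmul_eq_mul]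
  ring

open Finset in
/-- The uniform orbit mixture is a `G`-invariant probability weight. -/
theorem orbitMixture_invariant_nonneg_sum {G X : Type*} [Group G] [Fintype G] [MulAction G X]
    [Fintype X] [DecidableEq X] (a : X) (μ : X → ℝ)
    (hμ : ∀ x, μ x = (#{g : G | g • a = x} : ℝ) / Fintype.card G) :
    (∀ (g : G) (x : X), μ (g • x) = μ x) ∧ (∀ x, 0 ≤ μ x) ∧ ∑ x, μ x = 1 := by
  refine ⟨fun g x => ?_, fun x => ?_, ?_⟩
  · rw [hμ, hμ]
    congr 2
    refine card_equiv (Equiv.mulLeft g⁻¹) fun h => ?_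
    simp [mul_smul, inv_smul_eq_iff]
  · rw [hμ]
    positivity
  · simpa [← hμ] using sum_orbitMixture_mul (G := G) a fun _ => 1

/-- Averaging over the group does not change the expectation under an invariant weight. -/
theorem sum_mul_average_smul {G X : Type*} [Group G] [Fintype G] [MulAction G X] [Fintype X]
    (ν f : X → ℝ) (hν : ∀ (g : G) (x : X), ν (g • x) = ν x) :
    ∑ y, ν y * ((1 / (Fintype.card G : ℝ)) * ∑ g : G, f (g • y)) = ∑ y, ν y * f y := by
  have h : ∀ g : G, ∑ y, ν y * f (g • y) = ∑ y, ν y * f y := fun g => by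
    rw [← Equiv.sum_comp (MulAction.toPerm g) fun y => ν y * f y]
    simp [hν]
  calc _ = (1 / (Fintype.card G : ℝ)) * ∑ g : G, ∑ y, ν y * f (g • y) := by
        rw [Finset.sum_comm, Finset.mul_sum]
        refine Finset.sum_congr rfl fun y _ => ?_
        rw [← Finset.mul_sum]
        ring
    _ = _ := by simp [h]

/-- Proposition 2, achievability: the uniform orbit mixtures of an
other-play-optimal pair are symmetry-invariant probability weights whose
expected payoff equals the optimal other-play value, and hence they attain the
maximum expected payoff over all pairs of symmetry-invariant probability
weights. -/
theorem other_play_achievability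
    {G A B : Type*} [Group G] [Fintype G] [MulAction G A] [MulAction G B]
    [Fintype A] [Fintype B] [Nonempty A] [Nonempty B]
    [DecidableEq A] [DecidableEq B]
    (J : A → B → ℝ)
    (hJ : ∀ (g : G) (a : A) (b : B), J (g • a) (g • b) = J a b)
    (JOP : A → B → ℝ)
    (hOP : ∀ a b, JOP a b = (1 / (Fintype.card G : ℝ)) * ∑ g : G, J a (g • b))
    (astar : A) (bstar : B)
    (hmax : ∀ (a : A) (b : B), JOP a b ≤ JOP astar bstar)
    (μstar : A → ℝ) (νstar : B → ℝ)
    (hμstar : ∀ x, μstar x =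
      (((Finset.univ.filter fun g : G => g • astar = x).card : ℝ) / Fintype.card G))
    (hνstar : ∀ y, νstar y =
      (((Finset.univ.filter fun g : G => g • bstar = y).card : ℝ) / Fintype.card G)) :
    ((∀ (g : G) (x : A), μstar (g • x) = μstar x) ∧ (∀ x, 0 ≤ μstar x) ∧
        ∑ x : A, μstar x = 1) ∧
    ((∀ (g : G) (y : B), νstar (g • y) = νstar y) ∧ (∀ y, 0 ≤ νstar y) ∧
        ∑ y : B, νstar y = 1) ∧
    (∑ x : A, ∑ y : B, μstar x * νstar y * J x y = JOP astar bstar) ∧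
    (∀ (μ : A → ℝ) (ν : B → ℝ),
      (∀ x, 0 ≤ μ x) → (∑ x : A, μ x = 1) → (∀ (g : G) (x : A), μ (g • x) = μ x) →
      (∀ y, 0 ≤ ν y) → (∑ y : B, ν y = 1) → (∀ (g : G) (y : B), ν (g • y) = ν y) →
      ∑ x : A, ∑ y : B, μ x * ν y * J x y
        ≤ ∑ x : A, ∑ y : B, μstar x * νstar y * J x y) := by
  have hval : ∑ x : A, ∑ y : B, μstar x * νstar y * J x y = JOP astar bstar := by
    have hinv : ∀ g : G, JOP (g • astar) bstar = JOP astar bstar := fun g => by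
      rw [hOP, hOP, ← Equiv.sum_comp (Equiv.mulLeft g)]
      simp [mul_smul, hJ]
    simp_rw [mul_assoc, ← Finset.mul_sum, hνstar, sum_orbitMixture_mul, ← hOP, hμstar]
    rw [sum_orbitMixture_mul astar fun x => JOP x bstar]
    simp [hinv]
  refine ⟨orbitMixture_invariant_nonneg_sum astar μstar hμstar,
    orbitMixture_invariant_nonneg_sum bstar νstar hνstar, hval, ?_⟩
  intro μ ν hμ hμ1 _ hν hν1 hνinv
  rw [hval]
  calc ∑ x : A, ∑ y : B, μ x * ν y * J x y = ∑ x : A, μ x * ∑ y : B, ν y * JOP x y := by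
        simp_rw [mul_assoc, ← Finset.mul_sum, hOP, sum_mul_average_smul ν _ hνinv]
    _ ≤ ∑ x : A, μ x * ∑ y : B, ν y * JOP astar bstar := by
        gcongr with x _ y _
        · exact hμ x
        · exact hν y
        · exact hmax x y
    _ = JOP astar bstar := by rw [← Finset.sum_mul, ← Finset.sum_mul, hμ1, hν1, one_mul, one_mul]
end

section
/- Let G be a finite group acting on finite nonempty types A and B, and let J : A → B → ℝ satisfy diagonal invariance: J (g • a) (g • b) = J a b. Suppose (a*, b*) maximizes J_OP a b = (1/|G|) * ∑_{g ∈ G} J a (g • b) over A × B, and let μ* x = |{g ∈ G : g • a* = x}| / |G| and ν* y = |{g ∈ G : g • b* = y}| / |G| be the uniform orbit mixtures. Then for every G-invariant probability weight μ : A → ℝ (μ a ≥ 0, ∑_{a} μ a = 1, μ (g • a) = μ a), ∑_{x ∈ A} ∑_{y ∈ B} μ x * ν* y * J x y ≤ ∑_{x ∈ A} ∑_{y ∈ B} μ* x * ν* y * J x y; that is, against a partner playing the orbit mixture of an other-play-optimal policy, no symmetry-invariant deviation of player 1 improves the expected payoff. -/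
/-- The expectation of `f` under the uniform orbit mixture of `a` is the average of `f` along
the orbit map `g ↦ g • a`. -/
theorem sum_orbit_mixture_mul {G α : Type*} [Fintype G] [SMul G α] [Fintype α] [DecidableEq α]
    (a : α) (f : α → ℝ) :
    ∑ x : α, ((Finset.univ.filter fun g : G => g • a = x).card : ℝ) / Fintype.card G * f x
      = (1 / (Fintype.card G : ℝ)) * ∑ g : G, f (g • a) := by
  rw [← Finset.sum_fiberwise Finset.univ (fun g : G => g • a), Finset.mul_sum]
  refine Finset.sum_congr rfl fun x _ => ?_
  have h : ∑ g ∈ Finset.univ.filter (fun g : G => g • a = x), f (g • a)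
      = ((Finset.univ.filter fun g : G => g • a = x).card : ℝ) * f x := by
    rw [← nsmul_eq_mul]
    refine Finset.sum_eq_card_nsmul fun g hg => ?_
    rw [(Finset.mem_filter.mp hg).2]
  rw [h]
  ring

/-- Averaging a diagonally invariant payoff over the orbit of the second argument yields a
function invariant in the first argument. -/
theorem sum_smul_right_smul_left {G A B : Type*} [Group G] [Fintype G] [MulAction G A]
    [MulAction G B] {J : A → B → ℝ}
    (hJ : ∀ (g : G) (a : A) (b : B), J (g • a) (g • b) = J a b) (h : G) (a : A) (b : B) :
    ∑ g : G, J (h • a) (g • b) = ∑ g : G, J a (g • b) := by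
  rw [← Equiv.sum_comp (Equiv.mulLeft h)]
  simp [mul_smul, hJ]

/-- Proposition 2, equilibrium claim: against a partner playing the uniform
orbit mixture of an other-play-optimal policy, no symmetry-invariant deviation
of player 1 improves on the orbit mixture of the other-play-optimal policy. -/
theorem other_play_meta_equilibrium
    {G A B : Type*} [Group G] [Fintype G] [MulAction G A] [MulAction G B]
    [Fintype A] [Fintype B] [Nonempty A] [Nonempty B]
    [DecidableEq A] [DecidableEq B]
    (J : A → B → ℝ)
    (hJ : ∀ (g : G) (a : A) (b : B), J (g • a) (g • b) = J a b)
    (JOP : A → B → ℝ)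
    (hOP : ∀ a b, JOP a b = (1 / (Fintype.card G : ℝ)) * ∑ g : G, J a (g • b))
    (astar : A) (bstar : B)
    (hmax : ∀ (a : A) (b : B), JOP a b ≤ JOP astar bstar)
    (μstar : A → ℝ) (νstar : B → ℝ)
    (hμstar : ∀ x, μstar x =
      (((Finset.univ.filter fun g : G => g • astar = x).card : ℝ) / Fintype.card G))
    (hνstar : ∀ y, νstar y =
      (((Finset.univ.filter fun g : G => g • bstar = y).card : ℝ) / Fintype.card G))
    (μ : A → ℝ)
    (hμ0 : ∀ x, 0 ≤ μ x) (hμ1 : ∑ x : A, μ x = 1)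
    (hμinv : ∀ (g : G) (x : A), μ (g • x) = μ x) :
    ∑ x : A, ∑ y : B, μ x * νstar y * J x y
      ≤ ∑ x : A, ∑ y : B, μstar x * νstar y * J x y := by
  have hν : ∀ x, ∑ y : B, νstar y * J x y = JOP x bstar := fun x => by
    simp only [hνstar, hOP, sum_orbit_mixture_mul]
  have hJOP : ∀ g : G, JOP (g • astar) bstar = JOP astar bstar := fun g => by
    rw [hOP, hOP, sum_smul_right_smul_left hJ]
  simp only [mul_assoc, ← Finset.mul_sum, hν]
  calc ∑ x : A, μ x * JOP x bstar
      ≤ ∑ x : A, μ x * JOP astar bstar :=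
        Finset.sum_le_sum fun x _ => mul_le_mul_of_nonneg_left (hmax x bstar) (hμ0 x)
    _ = JOP astar bstar := by rw [← Finset.sum_mul, hμ1, one_mul]
    _ = ∑ x : A, μstar x * JOP x bstar := by
        simp only [hμstar, sum_orbit_mixture_mul, hJOP]
        simp
end

section
/- In the lever coordination game, let A = B = Fin 10, let v : Fin 10 → ℝ be given by v 0 = 9/10 and v i = 1 for i ≠ 0, and let J a b = if a = b then v a else 0. Let G be the stabilizer of 0 in the permutation group Equiv.Perm (Fin 10), acting on Fin 10 by evaluation, and define J_OP a b = (1/|G|) * ∑_{σ ∈ G} J a (σ • b). Then J_OP 0 0 = 9/10; J_OP a b = 1/9 whenever a ≠ 0 and b ≠ 0; and J_OP a b = 0 whenever exactly one of a, b equals 0. Consequently (0, 0) is the unique maximizer of J_OP over A × B. -/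
noncomputable instance :
    Fintype (MulAction.stabilizer (Equiv.Perm (Fin 10)) (0 : Fin 10)) :=
  Fintype.ofFinite _

section StabilizerAverage

open MulAction

variable {α : Type*} {x : α}

lemma smul_eq_base_iff (σ : stabilizer (Equiv.Perm α) x) {b : α} : σ • b = x ↔ b = x := by
  have hσ : σ • x = x := σ.2
  exact ⟨fun h => smul_left_cancel σ (h.trans hσ.symm), fun h => h ▸ hσ⟩

variable [DecidableEq α] [Fintype (stabilizer (Equiv.Perm α) x)]

/-- Away from the fixed point, the number of stabilizer elements carrying `b` to `a` does not
depend on `a`. -/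
lemma sum_stabilizer_indicator_congr {a a' : α} (ha : a ≠ x) (ha' : a' ≠ x) (b : α) :
    ∑ σ : stabilizer (Equiv.Perm α) x, (if a = σ • b then (1 : ℝ) else 0) =
      ∑ σ : stabilizer (Equiv.Perm α) x, if a' = σ • b then (1 : ℝ) else 0 := by
  let τ : stabilizer (Equiv.Perm α) x :=
    ⟨Equiv.swap a a', Equiv.swap_apply_of_ne_of_ne ha.symm ha'.symm⟩
  have hτ : τ • a = a' := Equiv.swap_apply_left a a'
  refine Fintype.sum_equiv (Equiv.mulLeft τ) _ _ fun σ => ?_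
  rw [Equiv.coe_mulLeft, mul_smul, ← hτ]
  simp only [smul_left_cancel_iff]

lemma card_sub_one_mul_sum_stabilizer_indicator [Fintype α] {a b : α} (ha : a ≠ x) (hb : b ≠ x) :
    ((Fintype.card α - 1 : ℕ) : ℝ) *
        ∑ σ : stabilizer (Equiv.Perm α) x, (if a = σ • b then (1 : ℝ) else 0) =
      Fintype.card (stabilizer (Equiv.Perm α) x) := by
  calc
    _ = ∑ c ∈ Finset.univ.erase x,
          ∑ σ : stabilizer (Equiv.Perm α) x, (if c = σ • b then (1 : ℝ) else 0) := by
      rw [Finset.sum_congr rfl fun c hc =>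
        sum_stabilizer_indicator_congr (Finset.ne_of_mem_erase hc) ha b]
      rw [Finset.sum_const, Finset.card_erase_of_mem (Finset.mem_univ x), Finset.card_univ,
        nsmul_eq_mul]
    _ = ∑ _σ : stabilizer (Equiv.Perm α) x, (1 : ℝ) := by
      rw [Finset.sum_comm]
      refine Finset.sum_congr rfl fun σ _ => ?_
      have hσ : σ • b ≠ x := fun h => hb ((smul_eq_base_iff σ).1 h)
      simp [hσ]
    _ = _ := by simp

end StabilizerAverage

/-- The lever coordination game: other-play gives the distinguished 0.9-payoff
lever value 9/10, gives any pair of (distinct-or-equal) 1-payoff levers value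
1/9, gives 0 when exactly one player picks lever 0, and hence (0,0) is the
unique maximizer of the other-play objective. -/
theorem lever_game_other_play
    (v : Fin 10 → ℝ) (hv0 : v 0 = 9 / 10) (hv1 : ∀ i : Fin 10, i ≠ 0 → v i = 1)
    (J : Fin 10 → Fin 10 → ℝ)
    (hJ : ∀ a b, J a b = if a = b then v a else 0)
    (JOP : Fin 10 → Fin 10 → ℝ)
    (hJOP : ∀ a b, JOP a b =
      (1 / (Fintype.card (MulAction.stabilizer (Equiv.Perm (Fin 10)) (0 : Fin 10)) : ℝ)) *
        ∑ σ : MulAction.stabilizer (Equiv.Perm (Fin 10)) (0 : Fin 10), J a (σ • b)) :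
    JOP 0 0 = 9 / 10 ∧
    (∀ a b : Fin 10, a ≠ 0 → b ≠ 0 → JOP a b = 1 / 9) ∧
    (∀ a b : Fin 10, (a = 0 ∧ b ≠ 0) ∨ (a ≠ 0 ∧ b = 0) → JOP a b = 0) ∧
    (∀ a b : Fin 10, JOP a b ≤ JOP 0 0) ∧
    (∀ a b : Fin 10, (∀ a' b' : Fin 10, JOP a' b' ≤ JOP a b) → a = 0 ∧ b = 0) := by
  have hcard : (Fintype.card (MulAction.stabilizer (Equiv.Perm (Fin 10)) (0 : Fin 10)) : ℝ) ≠ 0 :=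
    Nat.cast_ne_zero.2 Fintype.card_ne_zero
  have h00 : JOP 0 0 = 9 / 10 := by
    have hterm (σ : MulAction.stabilizer (Equiv.Perm (Fin 10)) (0 : Fin 10)) :
        J 0 (σ • (0 : Fin 10)) = 9 / 10 := by
      rw [hJ, if_pos ((smul_eq_base_iff σ).2 rfl).symm, hv0]
    simp only [hJOP, hterm, Finset.sum_const, Finset.card_univ, nsmul_eq_mul]
    field_simp
  have hpos : ∀ a b : Fin 10, a ≠ 0 → b ≠ 0 → JOP a b = 1 / 9 := by
    intro a b ha hb
    have hsum := card_sub_one_mul_sum_stabilizer_indicator ha hb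
    simp only [Fintype.card_fin] at hsum
    simp only [hJOP, hJ, hv1 a ha]
    rw [one_div_mul_eq_div, div_eq_div_iff hcard (by norm_num), ← hsum]
    push_cast
    ring
  have hzero : ∀ a b : Fin 10, (a = 0 ∧ b ≠ 0) ∨ (a ≠ 0 ∧ b = 0) → JOP a b = 0 := by
    intro a b hab
    rw [hJOP, Finset.sum_eq_zero, mul_zero]
    intro σ _
    rw [hJ, if_neg]
    rcases hab with ⟨rfl, hb⟩ | ⟨ha, rfl⟩
    · exact fun h => hb ((smul_eq_base_iff σ).1 h.symm)
    · exact fun h => ha (h.trans ((smul_eq_base_iff σ).2 rfl))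
  have hlt : ∀ a b : Fin 10, ¬(a = 0 ∧ b = 0) → JOP a b < JOP 0 0 := by
    intro a b hab
    rw [h00]
    by_cases ha : a = 0
    · rw [hzero a b (Or.inl ⟨ha, fun hb => hab ⟨ha, hb⟩⟩)]
      norm_num
    · by_cases hb : b = 0
      · rw [hzero a b (Or.inr ⟨ha, hb⟩)]
        norm_num
      · rw [hpos a b ha hb]
        norm_num
  refine ⟨h00, hpos, hzero, fun a b => ?_, fun a b hmax => ?_⟩
  · by_cases hab : a = 0 ∧ b = 0
    · rw [hab.1, hab.2]
    · exact (hlt a b hab).le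
  · by_contra hab
    exact (hlt a b hab).not_ge (hmax 0 0)
end
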